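/- Let R be a commutative Noetherian ring, a an ideal of R, M a finitely generated R-module, and n a non-negative integer. Then f_a^n(M) = h_a^n(M), i.e., the n-th finiteness dimension of M relative to a equals the least non-negative integer i such that the i-th local cohomology module H^i_a(M) is not in dimension < n. -/

import Mathlib

open CategoryTheory

noncomputable section

/-- An `R`-module `M` is *in dimension `< n`* if there exists a finitely generated
submodule `N ⊆ M` such that `dim Supp (M/N) < n`. -/
def InDimLT (R : Type) [CommRing R] (M : Type) [AddCommGroup M] [Module R M] (n : ℕ) : Prop :=
  ∃ N : Submodule R M, N.FG ∧ Order.krullDim (Module.support R (M ⧸ N)) < (n : WithBot ℕ∞)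

/-- The `i`-th local cohomology module of `M` with support in the ideal `a`. -/
def locCoh (R : Type) [CommRing R] (a : Ideal R) (i : ℕ)
    (M : Type) [AddCommGroup M] [Module R M] : ModuleCat R :=
  (localCohomology a i).obj (ModuleCat.of R M)

/-- The finiteness dimension `f_a(M)`:  the least `i` such that `H^i_a(M)` is not
finitely generated (`∞` if there is no such `i`). -/
def finDim (R : Type) [CommRing R] (a : Ideal R)
    (M : Type) [AddCommGroup M] [Module R M] : ℕ∞ :=
  sInf (Nat.cast '' {i : ℕ | ¬ Module.Finite R ↥(locCoh R a i M)})

/-- The `n`-th finiteness dimension `f_a^n(M)`. -/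
def finDimN (R : Type) [CommRing R] (a : Ideal R) (n : ℕ)
    (M : Type) [AddCommGroup M] [Module R M] : ℕ∞ :=
  sInf {d : ℕ∞ | ∃ p : PrimeSpectrum R,
    p ∈ Module.support R (M ⧸ (a • ⊤ : Submodule R M)) ∧
    (n : WithBot ℕ∞) ≤ ringKrullDim (R ⧸ p.asIdeal) ∧
    d = finDim (Localization.AtPrime p.asIdeal)
      (a.map (algebraMap R (Localization.AtPrime p.asIdeal)))
      (LocalizedModule p.asIdeal.primeCompl M)}

/-- `h_a^n(M)`: the least `i` such that `H^i_a(M)` is not in dimension `< n`. -/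
def hDimN (R : Type) [CommRing R] (a : Ideal R) (n : ℕ)
    (M : Type) [AddCommGroup M] [Module R M] : ℕ∞ :=
  sInf (Nat.cast '' {i : ℕ | ¬ InDimLT R ↥(locCoh R a i M) n})

namespace CategoryTheory

open Limits

variable {C D : Type*} [Category* C] [Category* D] [Abelian C] [Abelian D]

lemma exact_of_conj {X₁ X₂ X₃ Y₁ Y₂ Y₃ : D} {f : X₁ ⟶ X₂} {g : X₂ ⟶ X₃} {f' : Y₁ ⟶ Y₂}
    {g' : Y₂ ⟶ Y₃} {w' : f' ≫ g' = 0} {e₁ : X₁ ≅ Y₁} {e₂ : X₂ ≅ Y₂} {e₃ : X₃ ≅ Y₃}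
    (hf : f = e₁.hom ≫ f' ≫ e₂.inv) (hg : g = e₂.hom ≫ g' ≫ e₃.inv)
    (h : (ShortComplex.mk f' g' w').Exact) : ∃ w, (ShortComplex.mk f g w).Exact := by
  have w : f ≫ g = 0 := by simp [hf, hg, reassoc_of% w']
  exact ⟨w, (ShortComplex.exact_iff_of_iso (ShortComplex.isoMk e₁ e₂ e₃ (by simp [hf])
    (by simp [hg]))).2 h⟩

lemma naturality_of_conj {D : Type*} [Category* D] {A A' B B' K K' N N' : D} {e : A ≅ K}
    {e' : A' ≅ K'} {c : B ≅ N} {c' : B' ≅ N'} {u : A ⟶ A'} {v : B ⟶ B'} {p : K ⟶ K'} {q : N ⟶ N'} {d : K ⟶ N}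
    {d' : K' ⟶ N'} (hu : u ≫ e'.hom = e.hom ≫ p) (hv : c.inv ≫ v = q ≫ c'.inv)
    (hd : d ≫ q = p ≫ d') :
    u ≫ e'.hom ≫ d' ≫ c'.inv = (e.hom ≫ d ≫ c.inv) ≫ v := by
  rw [reassoc_of% hu, Category.assoc, Category.assoc, hv, reassoc_of% hd]

/-- A sequence `F₁ ⟶ F₂ ⟶ F₃` of additive functors which becomes short exact on every projective
object. -/
structure ProjShortExact {F₁ F₂ F₃ : C ⥤ D} (α : F₁ ⟶ F₂) (β : F₂ ⟶ F₃) : Prop where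
  zero : α ≫ β = 0
  shortExact (P : C) [Projective P] :
    (ShortComplex.mk (α.app P) (β.app P)
      (by rw [← NatTrans.comp_app, zero, zero_app])).ShortExact

namespace ProjShortExact

variable {F₁ F₂ F₃ : C ⥤ D} [F₁.Additive] [F₂.Additive] [F₃.Additive]
  {α : F₁ ⟶ F₂} {β : F₂ ⟶ F₃} (h : ProjShortExact α β)

/-- The short complex of chain complexes obtained by applying `F₁ ⟶ F₂ ⟶ F₃` to `K`. -/
@[simps]
def complexes (h : ProjShortExact α β) (K : ChainComplex C ℕ) :
    ShortComplex (ChainComplex D ℕ) where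
  X₁ := (F₁.mapHomologicalComplex _).obj K
  X₂ := (F₂.mapHomologicalComplex _).obj K
  X₃ := (F₃.mapHomologicalComplex _).obj K
  f := (NatTrans.mapHomologicalComplex α _).app K
  g := (NatTrans.mapHomologicalComplex β _).app K
  zero := by
    ext i
    exact NatTrans.congr_app h.zero (K.X i)

/-- Functoriality of `ProjShortExact.complexes`. -/
@[simps]
def complexesMap {K L : ChainComplex C ℕ} (φ : K ⟶ L) : h.complexes K ⟶ h.complexes L where
  τ₁ := (F₁.mapHomologicalComplex _).map φ
  τ₂ := (F₂.mapHomologicalComplex _).map φ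
  τ₃ := (F₃.mapHomologicalComplex _).map φ
  comm₁₂ := (NatTrans.mapHomologicalComplex α _).naturality φ
  comm₂₃ := (NatTrans.mapHomologicalComplex β _).naturality φ

lemma complexes_shortExact {X : C} (P : ProjectiveResolution X) :
    (h.complexes P.complex).ShortExact :=
  HomologicalComplex.shortExact_of_degreewise_shortExact _ fun i =>
    have := P.projective i
    h.shortExact (P.complex.X i)

variable [HasProjectiveResolutions C]

/-- The connecting homomorphism of left derived functors. -/
def δ (n : ℕ) : F₃.leftDerived (n + 1) ⟶ F₁.leftDerived n where
  app X := ((projectiveResolution X).isoLeftDerivedObj F₃ (n + 1)).hom ≫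
    (h.complexes_shortExact (projectiveResolution X)).δ (n + 1) n (ComplexShape.down_mk _ _ rfl) ≫
    ((projectiveResolution X).isoLeftDerivedObj F₁ n).inv
  naturality X Y f := by
    let P := projectiveResolution X
    let Q := projectiveResolution Y
    let φ := ProjectiveResolution.lift f P Q
    have comm : φ.f 0 ≫ Q.π.f 0 = P.π.f 0 ≫ f := ProjectiveResolution.lift_commutes_zero f P Q
    exact naturality_of_conj
      (ProjectiveResolution.isoLeftDerivedObj_hom_naturality f P Q φ comm F₃ (n + 1))
      (ProjectiveResolution.isoLeftDerivedObj_inv_naturality f P Q φ comm F₁ n)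
      (HomologicalComplex.HomologySequence.δ_naturality (h.complexesMap φ)
        (h.complexes_shortExact P) (h.complexes_shortExact Q) (n + 1) n
        (ComplexShape.down_mk _ _ rfl))

lemma exact₂ (h : ProjShortExact α β) (n : ℕ) (X : C) :
    ∃ w, (ShortComplex.mk ((NatTrans.leftDerived α n).app X)
      ((NatTrans.leftDerived β n).app X) w).Exact :=
  exact_of_conj ((projectiveResolution X).leftDerived_app_eq α n)
    ((projectiveResolution X).leftDerived_app_eq β n)
    ((h.complexes_shortExact (projectiveResolution X)).homology_exact₂ n)

lemma exact₁ (n : ℕ) (X : C) :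
    ∃ w, (ShortComplex.mk ((h.δ n).app X) ((NatTrans.leftDerived α n).app X) w).Exact :=
  exact_of_conj rfl ((projectiveResolution X).leftDerived_app_eq α n)
    ((h.complexes_shortExact (projectiveResolution X)).homology_exact₁ (n + 1) n
      (ComplexShape.down_mk _ _ rfl))

lemma exact₃ (n : ℕ) (X : C) :
    ∃ w, (ShortComplex.mk ((NatTrans.leftDerived β (n + 1)).app X) ((h.δ n).app X) w).Exact :=
  exact_of_conj ((projectiveResolution X).leftDerived_app_eq β (n + 1)) rfl
    ((h.complexes_shortExact (projectiveResolution X)).homology_exact₃ (n + 1) n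
      (ComplexShape.down_mk _ _ rfl))

end ProjShortExact

end CategoryTheory

namespace CategoryTheory

open Limits Opposite

variable {R : Type*} [Ring R] {C : Type*} [Category* C] [Abelian C] [Linear R C]

instance preservesFiniteLimits_linearYoneda_obj (Y : C) :
    PreservesFiniteLimits ((linearYoneda R C).obj Y) where
  preservesFiniteLimits J _ _ :=
    have : PreservesLimitsOfShape J ((linearYoneda R C).obj Y ⋙ forget (ModuleCat R)) :=
      inferInstanceAs (PreservesLimitsOfShape J (yoneda.obj Y))
    preservesLimitsOfShape_of_reflects_of_preserves _ (forget (ModuleCat R))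

instance preservesFiniteColimits_linearYoneda_obj_rightOp (Y : C) :
    PreservesFiniteColimits ((linearYoneda R C).obj Y).rightOp :=
  preservesFiniteColimits_rightOp _

lemma ShortComplex.ShortExact.linearYoneda {S : ShortComplex C} (hS : S.ShortExact) :
    ProjShortExact (((linearYoneda R C).map S.g).rightOp) (((linearYoneda R C).map S.f).rightOp)
    where
  zero := by
    ext X
    refine Quiver.Hom.unop_inj ?_
    ext (φ : X ⟶ S.X₁)
    change (φ ≫ S.f) ≫ S.g = 0
    simp
  shortExact P _ := by
    have := hS.mono_f
    have := hS.epi_g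
    let T : ShortComplex (ModuleCat R) :=
      ShortComplex.mk (((CategoryTheory.linearYoneda R C).map S.f).app (Opposite.op P))
        (((CategoryTheory.linearYoneda R C).map S.g).app (Opposite.op P)) (by
          ext (φ : P ⟶ S.X₁)
          change (φ ≫ S.f) ≫ S.g = 0
          simp)
    have hT : T.ShortExact := by
      refine ShortComplex.ShortExact.mk' ?_ ?_ ?_
      · rw [ShortComplex.ShortExact.moduleCat_exact_iff_function_exact]
        refine fun (φ : P ⟶ S.X₂) => ⟨fun (h : φ ≫ S.g = 0) => ?_, ?_⟩
        · exact ⟨hS.exact.lift φ h, hS.exact.lift_f φ h⟩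
        · rintro ⟨ψ : P ⟶ S.X₁, rfl⟩
          change (ψ ≫ S.f) ≫ S.g = 0
          simp
      · rw [ModuleCat.mono_iff_injective]
        intro (φ : P ⟶ S.X₁) (ψ : P ⟶ S.X₁) (h : φ ≫ S.f = ψ ≫ S.f)
        exact (cancel_mono S.f).1 h
      · rw [ModuleCat.epi_iff_surjective]
        exact fun (φ : P ⟶ S.X₃) => ⟨Projective.factorThru φ S.g, Projective.factorThru_comp φ S.g⟩
    exact hT.op

variable [EnoughProjectives C]

lemma isZero_leftDerived_linearYoneda_of_injective (Y : C) [Injective Y] (n : ℕ) (X : C) :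
    IsZero ((((linearYoneda R C).obj Y).rightOp.leftDerived (n + 1)).obj X) := by
  let P := projectiveResolution X
  refine IsZero.of_iso ?_ (P.isoLeftDerivedObj _ (n + 1))
  change IsZero (HomologicalComplex.homology _ _)
  rw [← HomologicalComplex.exactAt_iff_isZero_homology,
    HomologicalComplex.exactAt_iff' _ (n + 2) (n + 1) n (by simp) (by simp)]
  have e := P.exact_succ n
  let T : ShortComplex (ModuleCat R) :=
    ShortComplex.mk (((linearYoneda R C).obj Y).map (P.complex.d (n + 1) n).op)
      (((linearYoneda R C).obj Y).map (P.complex.d (n + 2) (n + 1)).op) (by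
        rw [← Functor.map_comp, ← op_comp, P.complex.d_comp_d, op_zero, Functor.map_zero])
  have hT : T.Exact := by
    rw [ShortComplex.ShortExact.moduleCat_exact_iff_function_exact]
    refine fun (φ : P.complex.X (n + 1) ⟶ Y) => ⟨fun (h : P.complex.d _ _ ≫ φ = 0) => ?_, ?_⟩
    · exact ⟨e.descToInjective φ h, e.comp_descToInjective φ h⟩
    · rintro ⟨ψ : P.complex.X n ⟶ Y, rfl⟩
      change P.complex.d (n + 2) (n + 1) ≫ P.complex.d (n + 1) n ≫ ψ = 0
      simp
  exact hT.op

/-- The connecting homomorphism of `Ext`, natural in the first variable. -/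
def ShortComplex.ShortExact.extδ {S : ShortComplex C} (hS : S.ShortExact) (n : ℕ) :
    (Ext R C n).flip.obj S.X₃ ⟶ (Ext R C (n + 1)).flip.obj S.X₁ :=
  NatTrans.leftOp (hS.linearYoneda.δ n)

lemma ShortComplex.ShortExact.ext_exact₂ {S : ShortComplex C} (hS : S.ShortExact) (n : ℕ)
    (X : Cᵒᵖ) : Function.Exact (((Ext R C n).obj X).map S.f) (((Ext R C n).obj X).map S.g) := by
  obtain ⟨w, h⟩ := hS.linearYoneda (R := R).exact₂ n X.unop
  exact (ShortComplex.ShortExact.moduleCat_exact_iff_function_exact _).1 h.unop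

lemma ShortComplex.ShortExact.ext_exact₁ {S : ShortComplex C} (hS : S.ShortExact) (n : ℕ)
    (X : Cᵒᵖ) :
    Function.Exact ((hS.extδ (R := R) n).app X) (((Ext R C (n + 1)).obj X).map S.f) := by
  obtain ⟨w, h⟩ := hS.linearYoneda (R := R).exact₃ n X.unop
  exact (ShortComplex.ShortExact.moduleCat_exact_iff_function_exact _).1 h.unop

lemma ShortComplex.ShortExact.ext_exact₃ {S : ShortComplex C} (hS : S.ShortExact) (n : ℕ)
    (X : Cᵒᵖ) :
    Function.Exact (((Ext R C n).obj X).map S.g) ((hS.extδ (R := R) n).app X) := by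
  obtain ⟨w, h⟩ := hS.linearYoneda (R := R).exact₁ n X.unop
  exact (ShortComplex.ShortExact.moduleCat_exact_iff_function_exact _).1 h.unop

lemma subsingleton_ext_succ_of_injective (Y : C) [Injective Y] (n : ℕ) (X : Cᵒᵖ) :
    Subsingleton (((Ext R C (n + 1)).obj X).obj Y) :=
  ModuleCat.subsingleton_of_isZero (isZero_leftDerived_linearYoneda_of_injective Y n X.unop).unop

end CategoryTheory

section LocalCohomology

open Limits Opposite

lemma exact_of_isColimit {R : Type} [CommRing R] {J : Type} [SmallCategory J] [IsFiltered J]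
    {K₁ K₂ K₃ : J ⥤ ModuleCat.{0} R} {c₁ : Cocone K₁} {c₂ : Cocone K₂} {c₃ : Cocone K₃}
    (h₁ : IsColimit c₁) (h₂ : IsColimit c₂) (h₃ : IsColimit c₃) (τ : K₁ ⟶ K₂) (σ : K₂ ⟶ K₃)
    (u : c₁.pt ⟶ c₂.pt) (v : c₂.pt ⟶ c₃.pt) (hu : ∀ j, c₁.ι.app j ≫ u = τ.app j ≫ c₂.ι.app j)
    (hv : ∀ j, c₂.ι.app j ≫ v = σ.app j ≫ c₃.ι.app j)
    (h : ∀ j, Function.Exact (τ.app j) (σ.app j)) : Function.Exact u v := by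
  have hu' (j) (x : K₁.obj j) : u (c₁.ι.app j x) = c₂.ι.app j (τ.app j x) :=
    ConcreteCategory.congr_hom (hu j) x
  have hv' (j) (x : K₂.obj j) : v (c₂.ι.app j x) = c₃.ι.app j (σ.app j x) :=
    ConcreteCategory.congr_hom (hv j) x
  intro y
  constructor
  · intro hy
    obtain ⟨j, y, rfl⟩ := Concrete.isColimit_exists_rep K₂ h₂ y
    rw [hv'] at hy
    obtain ⟨k, f, g, hk⟩ := Concrete.isColimit_exists_of_rep_eq K₃ h₃ (σ.app j y)
      (0 : K₃.obj j) (by rw [hy]; exact (map_zero (c₃.ι.app j).hom).symm)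
    have hk' : σ.app k (K₂.map f y) = 0 := by
      have := ConcreteCategory.congr_hom (σ.naturality f) y
      refine this.trans (hk.trans (map_zero (K₃.map g).hom))
    obtain ⟨x, hx⟩ := (h k _).1 hk'
    refine ⟨c₁.ι.app k x, ?_⟩
    rw [hu', hx]
    exact ConcreteCategory.congr_hom (c₂.w f) y
  · rintro ⟨x, rfl⟩
    obtain ⟨j, x, rfl⟩ := Concrete.isColimit_exists_rep K₁ h₁ x
    rw [hu', hv', (h j _).2 ⟨x, rfl⟩]
    exact map_zero (c₃.ι.app j).hom

variable {R : Type} [CommRing R] (a : Ideal R)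

/-- The diagram `k ↦ Ext^i(R/a^k, Y)` whose colimit is the local cohomology of `Y`. -/
def locCohDiagram (i : ℕ) (Y : ModuleCat.{0} R) : ℕᵒᵖᵒᵖ ⥤ ModuleCat.{0} R :=
  (localCohomology.ringModIdeals (localCohomology.idealPowersDiagram a)).op ⋙
    (Ext R (ModuleCat.{0} R) i).flip.obj Y

/-- The canonical cocone from `locCohDiagram` to local cohomology. -/
def locCohCocone (i : ℕ) (Y : ModuleCat.{0} R) : Cocone (locCohDiagram a i Y) :=
  ((evaluation _ _).obj Y).mapCocone
    (colimit.cocone (localCohomology.diagram (localCohomology.idealPowersDiagram a) i))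

/-- Local cohomology is the colimit of `locCohDiagram`. -/
def locCohIsColimit (i : ℕ) (Y : ModuleCat.{0} R) : IsColimit (locCohCocone a i Y) :=
  isColimitOfPreserves ((evaluation _ _).obj Y) (colimit.isColimit _)

variable {M N P : Type} [AddCommGroup M] [Module R M] [AddCommGroup N] [Module R N]
  [AddCommGroup P] [Module R P]

/-- The linear map on local cohomology induced by a linear map. -/
def locCohMap (i : ℕ) (f : M →ₗ[R] N) : locCoh R a i M →ₗ[R] locCoh R a i N :=
  ((localCohomology a i).map (ModuleCat.ofHom f)).hom

/-- The map `Ext^i(R/a^k, M) ⟶ Ext^i(R/a^k, N)` induced by a linear map, natural in `k`. -/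
def locCohDiagramMap (i : ℕ) {Y Z : ModuleCat.{0} R} (f : Y ⟶ Z) :
    locCohDiagram a i Y ⟶ locCohDiagram a i Z :=
  Functor.whiskerLeft _ ((Ext R (ModuleCat.{0} R) i).flip.map f)

lemma locCohCocone_ι_map (i : ℕ) {Y Z : ModuleCat.{0} R} (f : Y ⟶ Z) (k : ℕᵒᵖᵒᵖ) :
    (locCohCocone a i Y).ι.app k ≫ (localCohomology a i).map f =
      (locCohDiagramMap a i f).app k ≫ (locCohCocone a i Z).ι.app k :=
  ((((colimit.cocone (localCohomology.diagram
    (localCohomology.idealPowersDiagram a) i)).ι.app k).naturality f)).symm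

/-- The short complex of modules attached to an exact pair of linear maps. -/
lemma shortExact_ofHom {f : M →ₗ[R] N} {g : N →ₗ[R] P} (hf : Function.Injective f)
    (hfg : Function.Exact f g) (hg : Function.Surjective g) :
    ∃ w, (ShortComplex.mk (ModuleCat.ofHom f) (ModuleCat.ofHom g) w).ShortExact := by
  refine ⟨?_, ShortComplex.ShortExact.mk' ?_ ((ModuleCat.mono_iff_injective _).2 hf)
    ((ModuleCat.epi_iff_surjective _).2 hg)⟩
  · ext x
    exact hfg.apply_apply_eq_zero x
  · exact (ShortComplex.ShortExact.moduleCat_exact_iff_function_exact _).2 hfg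

lemma locCohMap_exact (i : ℕ) {f : M →ₗ[R] N} {g : N →ₗ[R] P} (hf : Function.Injective f)
    (hfg : Function.Exact f g) (hg : Function.Surjective g) :
    Function.Exact (locCohMap a i f) (locCohMap a i g) := by
  obtain ⟨w, h⟩ := shortExact_ofHom hf hfg hg
  exact exact_of_isColimit (locCohIsColimit a i _) (locCohIsColimit a i _) (locCohIsColimit a i _)
    (locCohDiagramMap a i (ModuleCat.ofHom f)) (locCohDiagramMap a i (ModuleCat.ofHom g))
    _ _ (locCohCocone_ι_map a i _) (locCohCocone_ι_map a i _) fun k => h.ext_exact₂ i _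

lemma exists_locCoh_connecting (i : ℕ) {f : M →ₗ[R] N} {g : N →ₗ[R] P}
    (hf : Function.Injective f) (hfg : Function.Exact f g) (hg : Function.Surjective g) :
    ∃ δ : locCoh R a i P →ₗ[R] locCoh R a (i + 1) M,
      Function.Exact (locCohMap a i g) δ ∧ Function.Exact δ (locCohMap a (i + 1) f) := by
  obtain ⟨w, h⟩ := shortExact_ofHom hf hfg hg
  let τ : locCohDiagram a i (ModuleCat.of R P) ⟶ locCohDiagram a (i + 1) (ModuleCat.of R M) :=
    Functor.whiskerLeft _ (h.extδ i)
  let d := (locCohIsColimit a i (ModuleCat.of R P)).map (locCohCocone a (i + 1) _) τ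
  have hd (k) : (locCohCocone a i (ModuleCat.of R P)).ι.app k ≫ d =
      τ.app k ≫ (locCohCocone a (i + 1) (ModuleCat.of R M)).ι.app k :=
    (locCohIsColimit a i (ModuleCat.of R P)).ι_map _ τ k
  refine ⟨d.hom, ?_, ?_⟩
  · exact exact_of_isColimit (locCohIsColimit a i _) (locCohIsColimit a i _)
      (locCohIsColimit a (i + 1) _) (locCohDiagramMap a i (ModuleCat.ofHom g)) τ _ d
      (locCohCocone_ι_map a i _) hd fun k => h.ext_exact₃ i _
  · exact exact_of_isColimit (locCohIsColimit a i _) (locCohIsColimit a (i + 1) _)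
      (locCohIsColimit a (i + 1) _) τ (locCohDiagramMap a (i + 1) (ModuleCat.ofHom f)) d _
      hd (locCohCocone_ι_map a (i + 1) _) fun k => h.ext_exact₁ i _

lemma subsingleton_locCoh_succ_of_injective [Module.Injective R M] (i : ℕ) :
    Subsingleton (locCoh R a (i + 1) M) := by
  have : Injective (ModuleCat.of R M) := Module.injective_object_of_injective_module R M
  refine subsingleton_of_forall_eq 0 fun x => ?_
  obtain ⟨k, x, rfl⟩ := Concrete.isColimit_exists_rep _ (locCohIsColimit a (i + 1) _) x
  have := subsingleton_ext_succ_of_injective (R := R) (ModuleCat.of R M) i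
    (op ((localCohomology.ringModIdeals (localCohomology.idealPowersDiagram a)).obj k.unop))
  have hx : x = 0 := this.elim _ _
  rw [hx]
  exact map_zero ((locCohCocone a (i + 1) (ModuleCat.of R M)).ι.app k).hom

end LocalCohomology

namespace CategoryTheory

lemma naturality_aux {D : Type*} [Category* D] {L L' H H' O O' X X' : D} (e : L ≅ H) (e' : L' ≅ H')
    (m : H ⟶ H') (ι : H ⟶ O) (ι' : H' ⟶ O') (p : O ⟶ X) (p' : O' ⟶ X') (q : X ⟶ X') {o : O ⟶ O'}
    (h : m ≫ ι' = ι ≫ o) (h' : o ≫ p' = p ≫ q) :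
    (e.hom ≫ m ≫ e'.inv) ≫ e'.hom ≫ ι' ≫ p' = (e.hom ≫ ι ≫ p) ≫ q := by
  simp only [Category.assoc, Iso.inv_hom_id_assoc, ← h', reassoc_of% h]

lemma fromLeftDerivedZero_naturality_functor {C D : Type*} [Category* C] [Category* D] [Abelian C]
    [Abelian D] [HasProjectiveResolutions C] {F G : C ⥤ D} [F.Additive] [G.Additive] (α : F ⟶ G) :
    NatTrans.leftDerived α 0 ≫ G.fromLeftDerivedZero = F.fromLeftDerivedZero ≫ α := by
  ext X
  let P := projectiveResolution X
  rw [NatTrans.comp_app, NatTrans.comp_app, P.fromLeftDerivedZero_eq F,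
    P.fromLeftDerivedZero_eq G, P.leftDerived_app_eq α 0]
  have h : HomologicalComplex.opcyclesMap
      ((NatTrans.mapHomologicalComplex α (ComplexShape.down ℕ)).app P.complex) 0 ≫
        P.fromLeftDerivedZero' G = P.fromLeftDerivedZero' F ≫ α.app X := by
    rw [← cancel_epi (HomologicalComplex.pOpcycles _ _)]
    rw [HomologicalComplex.p_opcyclesMap_assoc, P.pOpcycles_comp_fromLeftDerivedZero' G,
      ← Category.assoc (HomologicalComplex.pOpcycles _ _), P.pOpcycles_comp_fromLeftDerivedZero' F]
    exact (α.naturality _).symm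
  have h' := HomologicalComplex.homologyι_naturality
    ((NatTrans.mapHomologicalComplex α (ComplexShape.down ℕ)).app P.complex) 0
  exact naturality_aux _ _ _ _ _ _ _ _ h' h

end CategoryTheory

section TorsionPart

open Limits Opposite

variable {R : Type} [CommRing R] (a : Ideal R)

/-- The submodule of elements killed by a power of `a`. -/
def torsionPart (M : Type*) [AddCommGroup M] [Module R M] : Submodule R M where
  carrier := {x | ∃ k : ℕ, ∀ r ∈ a ^ k, r • x = 0}
  zero_mem' := ⟨0, by simp⟩
  add_mem' := by
    rintro x y ⟨k, hk⟩ ⟨l, hl⟩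
    refine ⟨k + l, fun r hr => ?_⟩
    rw [smul_add, hk r (Ideal.pow_le_pow_right (by simp) hr),
      hl r (Ideal.pow_le_pow_right (by simp) hr), add_zero]
  smul_mem' := by
    rintro c x ⟨k, hk⟩
    exact ⟨k, fun r hr => by rw [smul_comm, hk r hr, smul_zero]⟩

variable {M N : Type} [AddCommGroup M] [Module R M] [AddCommGroup N] [Module R N]

/-- `Ext^0` is `Hom`, naturally in the first variable. -/
def extZeroIso (Y : ModuleCat.{0} R) :
    (Ext R (ModuleCat.{0} R) 0).flip.obj Y ≅ (linearYoneda R (ModuleCat.{0} R)).obj Y :=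
  let e := ((linearYoneda R (ModuleCat.{0} R)).obj Y).rightOp.leftDerivedZeroIsoSelf
  { hom := NatTrans.leftOp e.inv
    inv := NatTrans.leftOp e.hom
    hom_inv_id := congrArg NatTrans.leftOp e.hom_inv_id
    inv_hom_id := congrArg NatTrans.leftOp e.inv_hom_id }

lemma extZeroIso_naturality {Y Z : ModuleCat.{0} R} (f : Y ⟶ Z) (X : (ModuleCat.{0} R)ᵒᵖ) :
    ((Ext R (ModuleCat.{0} R) 0).obj X).map f ≫ (extZeroIso Z).hom.app X =
      (extZeroIso Y).hom.app X ≫ ((linearYoneda R (ModuleCat.{0} R)).map f).app X := by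
  rw [← Iso.app_hom, ← Iso.app_hom, ← Iso.eq_comp_inv, Category.assoc, ← Iso.inv_comp_eq]
  have := NatTrans.congr_app
    (fromLeftDerivedZero_naturality_functor ((linearYoneda R (ModuleCat.{0} R)).map f).rightOp)
    X.unop
  exact (congrArg Quiver.Hom.unop this)

lemma mk_eq_smul_mk_one (I : Ideal R) (r : R) :
    Ideal.Quotient.mk I r = r • Ideal.Quotient.mk I 1 := by
  simp [Algebra.smul_def]

/-- The diagram `k ↦ Hom(R/a^k, Y)`. -/
def homDiagram (Y : ModuleCat.{0} R) : ℕᵒᵖᵒᵖ ⥤ ModuleCat.{0} R :=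
  (localCohomology.ringModIdeals (localCohomology.idealPowersDiagram a)).op ⋙
    (linearYoneda R (ModuleCat.{0} R)).obj Y

/-- The diagram of `Ext^0(R/a^k, Y)` is the diagram of `Hom(R/a^k, Y)`. -/
def locCohDiagramZeroIso (Y : ModuleCat.{0} R) : locCohDiagram a 0 Y ≅ homDiagram a Y :=
  Functor.isoWhiskerLeft _ (extZeroIso Y)

/-- Evaluation at `1`, as a cocone on `k ↦ Hom(R/a^k, Y)`. -/
def evalOneCocone (Y : ModuleCat.{0} R) : Cocone (homDiagram a Y) where
  pt := Y
  ι :=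
    { app k := ModuleCat.ofHom
        { toFun (φ : ModuleCat.of R (R ⧸ a ^ k.unop.unop) ⟶ Y) := φ (Ideal.Quotient.mk _ 1)
          map_add' _ _ := rfl
          map_smul' _ _ := rfl }
      naturality _ _ _ := rfl }

variable (M) in
/-- The canonical map from the zeroth local cohomology of `M` to `M`. -/
def locCohZeroι : locCoh R a 0 M →ₗ[R] M :=
  ((locCohIsColimit a 0 (ModuleCat.of R M)).desc
    ((Cocone.precompose (locCohDiagramZeroIso a _).hom).obj (evalOneCocone a _))).hom

lemma locCohZeroι_apply (k : ℕᵒᵖᵒᵖ) (x : (locCohDiagram a 0 (ModuleCat.of R M)).obj k) :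
    locCohZeroι a M ((locCohCocone a 0 _).ι.app k x) =
      (evalOneCocone a _).ι.app k ((locCohDiagramZeroIso a _).hom.app k x) :=
  ConcreteCategory.congr_hom
    ((locCohIsColimit a 0 (ModuleCat.of R M)).fac
      ((Cocone.precompose (locCohDiagramZeroIso a _).hom).obj (evalOneCocone a _)) k) x

lemma evalOneCocone_injective (Y : ModuleCat.{0} R) (k : ℕᵒᵖᵒᵖ)
    (φ : (homDiagram a Y).obj k) (h : (evalOneCocone a Y).ι.app k φ = 0) : φ = 0 := by
  refine ModuleCat.hom_ext (LinearMap.ext fun x => ?_)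
  obtain ⟨r, rfl⟩ := Ideal.Quotient.mk_surjective x
  have h' : (show ModuleCat.of R (R ⧸ a ^ k.unop.unop) ⟶ Y from φ) (Ideal.Quotient.mk _ 1) = 0 := h
  refine (congrArg (show ModuleCat.of R (R ⧸ a ^ k.unop.unop) ⟶ Y from φ).hom
    (mk_eq_smul_mk_one _ r)).trans ?_
  refine (map_smul (show ModuleCat.of R (R ⧸ a ^ k.unop.unop) ⟶ Y from φ).hom r _).trans ?_
  exact (congrArg (r • ·) h').trans (smul_zero r)

variable (M) in
lemma range_locCohZeroι : LinearMap.range (locCohZeroι a M) = torsionPart a M := by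
  ext x
  constructor
  · rintro ⟨y, rfl⟩
    obtain ⟨k, y, rfl⟩ := Concrete.isColimit_exists_rep _ (locCohIsColimit a 0 _) y
    refine ⟨k.unop.unop, fun r hr => ?_⟩
    refine (congrArg (r • ·) (locCohZeroι_apply a k y)).trans ?_
    let φ : ModuleCat.of R (R ⧸ a ^ k.unop.unop) ⟶ ModuleCat.of R M :=
      (locCohDiagramZeroIso a _).hom.app k y
    refine (map_smul φ.hom r (Ideal.Quotient.mk _ 1)).symm.trans ?_
    refine (congrArg φ.hom ?_).trans (map_zero φ.hom)
    rw [← mk_eq_smul_mk_one]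
    exact Ideal.Quotient.eq_zero_iff_mem.2 hr
  · rintro ⟨k, hk⟩
    let φ : ModuleCat.of R (R ⧸ a ^ k) ⟶ ModuleCat.of R M :=
      ModuleCat.ofHom (Submodule.liftQ (a ^ k) (LinearMap.toSpanSingleton R M x)
        fun r hr => by simpa using hk r hr)
    let K : ℕᵒᵖᵒᵖ := op (op k)
    refine ⟨(locCohCocone a 0 _).ι.app K ((locCohDiagramZeroIso a _).inv.app K φ), ?_⟩
    rw [locCohZeroι_apply]
    refine (congrArg _ (ConcreteCategory.congr_hom
      ((locCohDiagramZeroIso a (ModuleCat.of R M)).inv_hom_id_app K) φ)).trans ?_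
    exact (Submodule.liftQ_apply (a ^ k) (LinearMap.toSpanSingleton R M x) (h := fun r hr => by
      simpa using hk r hr) 1).trans (by simp)

variable (M) in
lemma locCohZeroι_injective : Function.Injective (locCohZeroι a M) := by
  rw [injective_iff_map_eq_zero]
  intro y hy
  obtain ⟨k, y, rfl⟩ := Concrete.isColimit_exists_rep _ (locCohIsColimit a 0 _) y
  have h := evalOneCocone_injective a _ k _ ((locCohZeroι_apply a k y).symm.trans hy)
  have h' : y = 0 := by
    have := congrArg ((locCohDiagramZeroIso a (ModuleCat.of R M)).inv.app k) h
    refine (ConcreteCategory.congr_hom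
      ((locCohDiagramZeroIso a (ModuleCat.of R M)).hom_inv_id_app k) y).symm.trans
        (this.trans (map_zero ((locCohDiagramZeroIso a (ModuleCat.of R M)).inv.app k).hom))
  rw [h']
  exact map_zero ((locCohCocone a 0 (ModuleCat.of R M)).ι.app k).hom

lemma locCohZeroι_naturality (f : M →ₗ[R] N) (x : locCoh R a 0 M) :
    locCohZeroι a N (locCohMap a 0 f x) = f (locCohZeroι a M x) := by
  obtain ⟨k, x, rfl⟩ := Concrete.isColimit_exists_rep _ (locCohIsColimit a 0 _) x
  have h : locCohMap a 0 f ((locCohCocone a 0 (ModuleCat.of R M)).ι.app k x) = _ :=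
    ConcreteCategory.congr_hom (locCohCocone_ι_map a 0 (ModuleCat.ofHom f) k) x
  refine (congrArg _ h).trans ?_
  refine (locCohZeroι_apply a k _).trans ?_
  refine Eq.trans ?_ (congrArg f (locCohZeroι_apply a k x)).symm
  exact congrArg ((evalOneCocone a (ModuleCat.of R N)).ι.app k)
    (ConcreteCategory.congr_hom (extZeroIso_naturality (ModuleCat.ofHom f)
      ((localCohomology.ringModIdeals (localCohomology.idealPowersDiagram a)).op.obj k)) x)

variable (M) in
/-- The zeroth local cohomology is the torsion part. -/
def locCohZeroEquiv : locCoh R a 0 M ≃ₗ[R] torsionPart a M :=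
  (LinearEquiv.ofInjective _ (locCohZeroι_injective a M)).trans
    (LinearEquiv.ofEq _ _ (range_locCohZeroι a M))

end TorsionPart

section Torsion

variable {R : Type} [CommRing R] (a : Ideal R)
variable {M N : Type*} [AddCommGroup M] [Module R M] [AddCommGroup N] [Module R N]

variable {a} in
lemma mem_torsionPart {x : M} : x ∈ torsionPart a M ↔ ∃ k : ℕ, ∀ r ∈ a ^ k, r • x = 0 := Iff.rfl

variable {a} in
lemma map_mem_torsionPart (f : M →ₗ[R] N) {x : M} (hx : x ∈ torsionPart a M) :
    f x ∈ torsionPart a N := by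
  obtain ⟨k, hk⟩ := hx
  exact ⟨k, fun r hr => by rw [← map_smul, hk r hr, map_zero]⟩

variable {a} in
lemma mem_torsionPart_of_map {f : M →ₗ[R] N} (hf : Function.Injective f) {x : M}
    (hx : f x ∈ torsionPart a N) : x ∈ torsionPart a M := by
  obtain ⟨k, hk⟩ := hx
  exact ⟨k, fun r hr => hf (by rw [map_smul, hk r hr, map_zero])⟩

lemma torsionPart_torsionPart : torsionPart a (torsionPart a M) = ⊤ :=
  eq_top_iff.2 fun x _ => mem_torsionPart_of_map (Submodule.subtype_injective _) x.2

variable {a} in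
lemma torsionPart_eq_top_of_surjective (h : torsionPart a M = ⊤) {f : M →ₗ[R] N}
    (hf : Function.Surjective f) : torsionPart a N = ⊤ := by
  refine eq_top_iff.2 fun y _ => ?_
  obtain ⟨x, rfl⟩ := hf y
  exact map_mem_torsionPart f (h ▸ Submodule.mem_top)

/-- A finitely generated submodule of the torsion part is killed by a power of the ideal. -/
lemma exists_pow_smul_eq_zero {P : Submodule R M} (hP : P.FG) (h : P ≤ torsionPart a M) :
    ∃ k : ℕ, ∀ r ∈ a ^ k, ∀ x ∈ P, r • x = 0 := by
  obtain ⟨s, rfl⟩ := hP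
  have h' (x : s) : ∃ k : ℕ, ∀ r ∈ a ^ k, r • (x : M) = 0 := h (Submodule.subset_span x.2)
  choose k hk using h'
  refine ⟨Finset.univ.sup k, fun r hr x hx => ?_⟩
  induction hx using Submodule.span_induction with
  | mem x hx =>
    exact hk ⟨x, hx⟩ r (Ideal.pow_le_pow_right (Finset.le_sup (Finset.mem_univ _)) hr)
  | zero => simp
  | add x y _ _ hx hy => rw [smul_add, hx, hy, add_zero]
  | smul c x _ hx => rw [smul_comm, hx, smul_zero]

variable [IsNoetherianRing R]

variable {a} in
lemma mem_torsionPart_of_forall_smul_mem {x : M} {k : ℕ}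
    (h : ∀ r ∈ a ^ k, r • x ∈ torsionPart a M) : x ∈ torsionPart a M := by
  obtain ⟨l, hl⟩ := exists_pow_smul_eq_zero a
    (P := Submodule.map (LinearMap.toSpanSingleton R M x) (a ^ k))
    ((IsNoetherian.noetherian (a ^ k)).map _)
    (by rintro _ ⟨r, hr, rfl⟩; exact h r hr)
  refine ⟨l + k, fun r hr => ?_⟩
  rw [pow_add] at hr
  induction hr using Submodule.mul_induction_on' with
  | mem_mul_mem s hs t ht =>
    rw [mul_smul]
    exact hl s hs _ ⟨t, ht, rfl⟩
  | add s _ t _ hs ht => rw [add_smul, hs, ht, add_zero]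

variable (M) in
lemma torsionPart_quotient_torsionPart : torsionPart a (M ⧸ torsionPart a M) = ⊥ := by
  refine eq_bot_iff.2 fun x hx => ?_
  obtain ⟨x, rfl⟩ := Submodule.mkQ_surjective _ x
  obtain ⟨k, hk⟩ := hx
  rw [Submodule.mem_bot, Submodule.mkQ_apply, Submodule.Quotient.mk_eq_zero]
  refine mem_torsionPart_of_forall_smul_mem (k := k) fun r hr => ?_
  rw [← Submodule.Quotient.mk_eq_zero, Submodule.Quotient.mk_smul]
  exact hk r hr

/-- The torsion part of an injective module is injective. -/
lemma injective_torsionPart {E : Type} [AddCommGroup E] [Module R E] [Module.Injective R E] :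
    Module.Injective R (torsionPart a E) := by
  refine Module.Baer.injective fun J f => ?_
  obtain ⟨k, hk⟩ := exists_pow_smul_eq_zero a (P := LinearMap.range f)
    (by rw [LinearMap.range_eq_map]; exact (Module.Finite.fg_top (R := R) (M := J)).map f)
    (by rw [torsionPart_torsionPart]; exact le_top)
  obtain ⟨m, hm⟩ := Ideal.exists_pow_inf_eq_pow_smul a (J : Submodule R R)
  have hf (x : R) (hx : x ∈ a ^ (m + k)) (hJ : x ∈ J) : f ⟨x, hJ⟩ = 0 := by
    have h₁ : x ∈ a ^ k • (a ^ m • (⊤ : Submodule R R) ⊓ J) := by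
      rw [← Nat.add_sub_cancel_left (n := m) (m := k), ← hm (m + k) (by lia)]
      exact ⟨by simpa using hx, hJ⟩
    have h₂ : x ∈ a ^ k • (J : Submodule R R) := Submodule.smul_mono le_rfl inf_le_right h₁
    have h₃ : a ^ k • (J : Submodule R R) ≤ (LinearMap.ker f).map J.subtype := by
      refine Submodule.smul_le.2 fun r hr y hy => ?_
      refine ⟨r • ⟨y, hy⟩, ?_, rfl⟩
      have := hk r hr (f ⟨y, hy⟩) ⟨_, rfl⟩
      rwa [← map_smul] at this
    obtain ⟨y, hy, rfl⟩ := h₃ h₂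
    exact hy
  let F : R →ₗ.[R] E := ⟨J, (torsionPart a E).subtype ∘ₗ f⟩
  let G : R →ₗ.[R] E := ⟨a ^ (m + k), 0⟩
  have hFG (x : F.domain) (y : G.domain) (hxy : (x : R) = y) : F x = G y := by
    have hx : (x : R) ∈ a ^ (m + k) := hxy ▸ y.2
    exact congrArg Subtype.val (hf x hx x.2)
  obtain ⟨g, hg⟩ := Module.Baer.of_injective (inferInstanceAs (Module.Injective R E))
    (F.sup G hFG).domain (F.sup G hFG).toFun
  have hg₁ (x : J) : g x = f x :=
    (hg x (show (x : R) ∈ F.domain ⊔ G.domain from Submodule.mem_sup_left x.2)).trans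
      (((F.left_le_sup G hFG).2 (x := x) rfl).symm)
  have hg₂ (x : R) (hx : x ∈ a ^ (m + k)) : g x = 0 :=
    (hg x (show (x : R) ∈ F.domain ⊔ G.domain from Submodule.mem_sup_right hx)).trans
      (((F.right_le_sup G hFG).2 (x := ⟨x, hx⟩) rfl).symm)
  have hg₃ (r : R) : g r ∈ torsionPart a E := by
    have : g 1 ∈ torsionPart a E :=
      ⟨m + k, fun r hr => by rw [← map_smul, smul_eq_mul, mul_one, hg₂ r hr]⟩
    simpa [← map_smul] using (torsionPart a E).smul_mem r this
  exact ⟨g.codRestrict _ hg₃, fun x hx => Subtype.ext (hg₁ ⟨x, hx⟩)⟩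

end Torsion

section Recursion

variable (R : Type) [CommRing R]

lemma exists_injective_embedding (M : Type) [AddCommGroup M] [Module R M] :
    ∃ (E : Type) (_ : AddCommGroup E) (_ : Module R E) (f : M →ₗ[R] E),
      Module.Injective R E ∧ Function.Injective f := by
  refine ⟨(Injective.under (ModuleCat.of R M)).carrier, inferInstance, inferInstance,
    (Injective.ι (ModuleCat.of R M)).hom, ?_, ?_⟩
  · exact Module.injective_module_of_injective_object R _
      (inj := inferInstanceAs (Injective (Injective.under (ModuleCat.of R M))))
  · exact (ModuleCat.mono_iff_injective _).1 inferInstance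

variable {R} (a : Ideal R)
variable {M N P : Type} [AddCommGroup M] [Module R M] [AddCommGroup N] [Module R N]
  [AddCommGroup P] [Module R P]

lemma subsingleton_of_exact {f : M →ₗ[R] N} {g : N →ₗ[R] P} (h : Function.Exact f g)
    [Subsingleton M] [Subsingleton P] : Subsingleton N :=
  subsingleton_of_forall_eq 0 fun x => by
    obtain ⟨y, rfl⟩ := (h x).1 (Subsingleton.elim _ _)
    rw [Subsingleton.elim y 0, map_zero]

lemma subsingleton_locCoh_zero (h : torsionPart a M = ⊥) : Subsingleton (locCoh R a 0 M) :=
  have : Subsingleton (torsionPart a M) := by rw [h]; infer_instance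
  (locCohZeroEquiv a M).toEquiv.subsingleton

lemma ker_mkQ_comp_le {f : M →ₗ[R] N} (hf : Function.Injective f) :
    LinearMap.ker ((torsionPart a N).mkQ ∘ₗ f) ≤ torsionPart a M := fun x hx =>
  mem_torsionPart_of_map hf (by simpa using hx)

variable [IsNoetherianRing R]

lemma subsingleton_locCoh_succ_of_torsion (i : ℕ) (h : torsionPart a M = ⊤) :
    Subsingleton (locCoh R a (i + 1) M) := by
  induction i generalizing M with
  | zero =>
    obtain ⟨E, _, _, f, hE, hf⟩ := exists_injective_embedding R M
    have := injective_torsionPart a (E := E)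
    let g : M →ₗ[R] torsionPart a E :=
      f.codRestrict _ fun x => map_mem_torsionPart f (h ▸ Submodule.mem_top)
    have hg : Function.Injective g := fun x y hxy => hf (congrArg Subtype.val hxy)
    have hq := LinearMap.exact_map_mkQ_range g
    have hs := (LinearMap.range g).mkQ_surjective
    obtain ⟨δ, h₁, h₂⟩ := exists_locCoh_connecting a 0 hg hq hs
    have := subsingleton_locCoh_succ_of_injective (R := R) (M := torsionPart a E) a 0
    refine subsingleton_of_forall_eq 0 fun x => ?_
    obtain ⟨y, rfl⟩ := (h₂ x).1 (Subsingleton.elim _ _)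
    refine (h₁ y).2 ?_
    obtain ⟨z, hz⟩ := hs (locCohZeroι a _ y)
    have hz' : z ∈ LinearMap.range (locCohZeroι a (torsionPart a E)) := by
      rw [range_locCohZeroι, torsionPart_torsionPart]
      exact Submodule.mem_top
    obtain ⟨z, rfl⟩ := hz'
    exact ⟨z, locCohZeroι_injective a _ (by rw [locCohZeroι_naturality, hz])⟩
  | succ i ih =>
    obtain ⟨E, _, _, f, hE, hf⟩ := exists_injective_embedding R M
    have := injective_torsionPart a (E := E)
    let g : M →ₗ[R] torsionPart a E :=
      f.codRestrict _ fun x => map_mem_torsionPart f (h ▸ Submodule.mem_top)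
    have hg : Function.Injective g := fun x y hxy => hf (congrArg Subtype.val hxy)
    have hq := LinearMap.exact_map_mkQ_range g
    have hs := (LinearMap.range g).mkQ_surjective
    obtain ⟨δ, -, h₂⟩ := exists_locCoh_connecting a (i + 1) hg hq hs
    have := subsingleton_locCoh_succ_of_injective (R := R) (M := torsionPart a E) a (i + 1)
    have := ih (torsionPart_eq_top_of_surjective (torsionPart_torsionPart a) hs)
    exact subsingleton_of_exact h₂

/-- A surjection with torsion kernel induces isomorphisms on higher local cohomology. -/
lemma bijective_locCohMap_succ (i : ℕ) {f : M →ₗ[R] N} (hf : Function.Surjective f)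
    (h : LinearMap.ker f ≤ torsionPart a M) : Function.Bijective (locCohMap a (i + 1) f) := by
  have ht : torsionPart a (LinearMap.ker f) = ⊤ :=
    eq_top_iff.2 fun x _ => mem_torsionPart_of_map (Submodule.subtype_injective _) (h x.2)
  have h₁ := locCohMap_exact a (i + 1) (Submodule.subtype_injective _)
    (LinearMap.exact_subtype_ker_map f) hf
  obtain ⟨δ, h₂, h₃⟩ := exists_locCoh_connecting a (i + 1) (Submodule.subtype_injective _)
    (LinearMap.exact_subtype_ker_map f) hf
  have := subsingleton_locCoh_succ_of_torsion a i ht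
  have := subsingleton_locCoh_succ_of_torsion a (i + 1) ht
  constructor
  · rw [injective_iff_map_eq_zero]
    intro x hx
    obtain ⟨y, rfl⟩ := (h₁ x).1 hx
    rw [Subsingleton.elim y 0, map_zero]
  · exact fun y => (h₂ y).1 (Subsingleton.elim _ _)

/-- Dimension shifting for local cohomology. -/
lemma nonempty_locCoh_succ_equiv (i : ℕ) (f : M →ₗ[R] N)
    (h : LinearMap.ker f ≤ torsionPart a M) (hN : ∀ j, Subsingleton (locCoh R a j N)) :
    Nonempty (locCoh R a (i + 1) M ≃ₗ[R] locCoh R a i (N ⧸ LinearMap.range f)) := by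
  obtain ⟨δ, h₁, h₂⟩ := exists_locCoh_connecting a i (LinearMap.range f).subtype_injective
    (LinearMap.exact_subtype_mkQ (LinearMap.range f)) (LinearMap.range f).mkQ_surjective
  have := hN i
  have := hN (i + 1)
  have hδ : Function.Bijective δ := by
    constructor
    · rw [injective_iff_map_eq_zero]
      intro x hx
      obtain ⟨y, rfl⟩ := (h₁ x).1 hx
      rw [Subsingleton.elim y 0, map_zero]
    · exact fun y => (h₂ y).1 (Subsingleton.elim _ _)
  exact ⟨(LinearEquiv.ofBijective _ (bijective_locCohMap_succ a i
    (LinearMap.surjective_rangeRestrict f) (by rwa [LinearMap.ker_rangeRestrict]))).trans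
    (LinearEquiv.ofBijective δ hδ).symm⟩

lemma subsingleton_locCoh_quotient_torsionPart [Module.Injective R M] (j : ℕ) :
    Subsingleton (locCoh R a j (M ⧸ torsionPart a M)) := by
  cases j with
  | zero => exact subsingleton_locCoh_zero a (torsionPart_quotient_torsionPart a M)
  | succ j =>
    have := subsingleton_locCoh_succ_of_injective (R := R) (M := M) a j
    exact (bijective_locCohMap_succ a j (Submodule.mkQ_surjective _)
      (by rw [Submodule.ker_mkQ])).2.subsingleton

lemma torsionPart_locCoh (i : ℕ) (M : Type) [AddCommGroup M] [Module R M] :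
    torsionPart a (locCoh R a i M) = ⊤ := by
  induction i generalizing M with
  | zero =>
    exact torsionPart_eq_top_of_surjective (torsionPart_torsionPart a)
      (locCohZeroEquiv a M).symm.surjective
  | succ i ih =>
    obtain ⟨E, _, _, f, hE, hf⟩ := exists_injective_embedding R M
    obtain ⟨e⟩ := nonempty_locCoh_succ_equiv a i _ (ker_mkQ_comp_le a hf)
      (subsingleton_locCoh_quotient_torsionPart a)
    exact torsionPart_eq_top_of_surjective (ih _) e.symm.surjective

end Recursion

section Localization

variable {R : Type} [CommRing R] (S : Submonoid R)
variable (A : Type) [CommRing A] [Algebra R A] [IsLocalization S A]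
variable {M M' : Type} [AddCommGroup M] [Module R M] [AddCommGroup M'] [Module R M']
  [Module A M'] [IsScalarTower R A M'] (f : M →ₗ[R] M') [IsLocalizedModule S f]

lemma exists_smul_eq_zero_of_fg {P : Submodule R M} (hP : P.FG) (h : ∀ x ∈ P, f x = 0) :
    ∃ c : S, ∀ x ∈ P, c • x = 0 := by
  induction P, hP using Submodule.fg_induction with
  | singleton x =>
    obtain ⟨c, hc⟩ := (IsLocalizedModule.eq_zero_iff S f).1
      (h x (Submodule.mem_span_singleton_self x))
    refine ⟨c, fun y hy => ?_⟩
    obtain ⟨r, rfl⟩ := Submodule.mem_span_singleton.1 hy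
    rw [smul_comm, hc, smul_zero]
  | sup P Q hP hQ ihP ihQ =>
    obtain ⟨c, hc⟩ := ihP fun x hx => h x (Submodule.mem_sup_left hx)
    obtain ⟨d, hd⟩ := ihQ fun x hx => h x (Submodule.mem_sup_right hx)
    refine ⟨c * d, fun x hx => ?_⟩
    obtain ⟨y, hy, z, hz, rfl⟩ := Submodule.mem_sup.1 hx
    rw [smul_add, mul_smul c d z, hd z hz, mul_comm, mul_smul d c y, hc y hy, smul_zero, smul_zero,
      add_zero]

/-- Localization commutes with torsion parts. -/
lemma localized'_torsionPart [IsNoetherianRing R] (a : Ideal R) :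
    (torsionPart a M).localized' A S f = torsionPart (a.map (algebraMap R A)) M' := by
  ext x
  obtain ⟨⟨m, s⟩, rfl⟩ := IsLocalizedModule.mk'_surjective S f x
  constructor
  · rintro ⟨m', ⟨k, hk⟩, s', h⟩
    rw [← h]
    refine ⟨k, fun r hr => ?_⟩
    rw [← Ideal.map_pow] at hr
    have h' : (a ^ k).map (algebraMap R A) ≤
        LinearMap.ker (LinearMap.toSpanSingleton A M' (IsLocalizedModule.mk' f m' s')) := by
      refine Ideal.map_le_iff_le_comap.2 fun t ht => ?_
      simp [algebraMap_smul, ← IsLocalizedModule.mk'_smul, hk t ht]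
    exact h' hr
  · rintro ⟨k, hk⟩
    obtain ⟨c, hc⟩ := exists_smul_eq_zero_of_fg S f
      (P := Submodule.map (LinearMap.toSpanSingleton R M m) (a ^ k))
      ((IsNoetherian.noetherian (a ^ k)).map _) (by
        rintro _ ⟨r, hr, rfl⟩
        have := hk (algebraMap R A r) (by
          rw [← Ideal.map_pow]
          exact Ideal.mem_map_of_mem _ hr)
        rw [algebraMap_smul] at this
        have h' := congrArg (s • ·) this
        simpa [smul_comm s r] using h')
    refine ⟨c • m, ⟨k, fun r hr => ?_⟩, c * s, ?_⟩
    · rw [smul_comm]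
      exact hc _ ⟨r, hr, rfl⟩
    · exact IsLocalizedModule.mk'_cancel_left f m c s

/-- Localizations of injective modules over Noetherian rings are injective. -/
lemma injective_of_isLocalizedModule {R : Type} [CommRing R] [IsNoetherianRing R] (S : Submonoid R)
    (A : Type) [CommRing A] [Algebra R A] [IsLocalization S A] {M M' : Type} [AddCommGroup M]
    [Module R M] [AddCommGroup M'] [Module R M'] [Module A M'] [IsScalarTower R A M']
    (f : M →ₗ[R] M') [IsLocalizedModule S f] [Module.Injective R M] : Module.Injective A M' := by
  refine Module.Baer.injective fun J φ => ?_
  let I : Ideal R := J.comap (algebraMap R A)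
  let ι : I →ₗ[R] J := (Algebra.linearMap R A).restrict (p := I) (q := J.restrictScalars R)
    fun x hx => hx
  have := Module.finitePresentation_of_finite R I
  obtain ⟨h, s, hs⟩ := Module.FinitePresentation.exists_lift_of_isLocalizedModule S f
    (φ.restrictScalars R ∘ₗ ι)
  obtain ⟨g, hg⟩ := Module.Baer.of_injective (inferInstanceAs (Module.Injective R M)) I h
  let w : M' := IsLocalizedModule.mk' f (g 1) s
  refine ⟨LinearMap.toSpanSingleton A M' w, fun x hx => ?_⟩
  obtain ⟨r, t, rfl⟩ := IsLocalization.exists_mk'_eq S x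
  have hr : r ∈ I := by
    have := J.mul_mem_left (algebraMap R A t) hx
    rwa [IsLocalization.mk'_spec'] at this
  have h₁ : s • φ (ι ⟨r, hr⟩) = r • f (g 1) := by
    have := LinearMap.congr_fun hs ⟨r, hr⟩
    rw [LinearMap.comp_apply, ← hg r hr] at this
    refine this.symm.trans ?_
    rw [← map_smul, ← map_smul, smul_eq_mul, mul_one]
  have h₂ : φ (ι ⟨r, hr⟩) = r • w := by
    refine IsLocalizedModule.smul_injective f s ?_
    change s • _ = s • _
    rw [h₁, smul_comm s r w, IsLocalizedModule.mk'_cancel']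
  have h₃ : ι ⟨r, hr⟩ = (t : R) • (⟨IsLocalization.mk' A r t, hx⟩ : J) := by
    refine Subtype.ext ?_
    change algebraMap R A r = (t : R) • IsLocalization.mk' A r t
    rw [Algebra.smul_def, IsLocalization.mk'_spec']
  refine IsLocalizedModule.smul_injective f t ?_
  change t • _ = t • _
  have h₄ : (t : R) • φ ⟨_, hx⟩ = r • w := by
    rw [← h₂, h₃]
    exact ((φ.restrictScalars R).map_smul (t : R) ⟨_, hx⟩).symm
  rw [Submonoid.smul_def, Submonoid.smul_def, h₄]
  rw [LinearMap.toSpanSingleton_apply, ← smul_assoc, Algebra.smul_def, IsLocalization.mk'_spec',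
    algebraMap_smul]

/-- Local cohomology commutes with localization. -/
theorem nonempty_localizedModule_locCoh_equiv {R : Type} [CommRing R] [IsNoetherianRing R]
    (S : Submonoid R) (a : Ideal R) (i : ℕ) {M M' : Type} [AddCommGroup M]
    [Module R M] [AddCommGroup M'] [Module R M'] [Module (Localization S) M']
    [IsScalarTower R (Localization S) M'] (f : M →ₗ[R] M') [IsLocalizedModule S f] :
    Nonempty (LocalizedModule S (locCoh R a i M) ≃ₗ[Localization S]
      locCoh (Localization S) (a.map (algebraMap R (Localization S))) i M') := by
  have : IsNoetherianRing (Localization S) := IsLocalization.isNoetherianRing S _ inferInstance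
  induction i generalizing M M' with
  | zero =>
    refine ⟨?_⟩
    let e₁ := IsLocalizedModule.mapEquiv S (LocalizedModule.mkLinearMap S (locCoh R a 0 M))
      (LocalizedModule.mkLinearMap S (torsionPart a M)) (Localization S) (locCohZeroEquiv a M)
    let e₂ := (IsLocalizedModule.linearEquiv S (LocalizedModule.mkLinearMap S (torsionPart a M))
      ((torsionPart a M).toLocalized' (Localization S) S f)).extendScalarsOfIsLocalization S
        (Localization S)
    let e₃ := LinearEquiv.ofEq _ _ (localized'_torsionPart S (Localization S) f a)
    exact (e₁.trans e₂).trans (e₃.trans (locCohZeroEquiv _ M').symm)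
  | succ i ih =>
    obtain ⟨E, _, _, g, hE, hg⟩ := exists_injective_embedding R M
    have hg' := ker_mkQ_comp_le a hg
    have hE' := subsingleton_locCoh_quotient_torsionPart a (M := E)
    generalize (torsionPart a E).mkQ ∘ₗ g = g' at hg'
    obtain ⟨e⟩ := nonempty_locCoh_succ_equiv a i g' hg' hE'
    let l := (torsionPart a E).toLocalizedQuotient' (Localization S) S
      (LocalizedModule.mkLinearMap S E)
    have hl : ∀ j, Subsingleton (locCoh (Localization S) (a.map (algebraMap R (Localization S))) j
        (LocalizedModule S E ⧸ (torsionPart a E).localized' (Localization S) S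
          (LocalizedModule.mkLinearMap S E))) := by
      rw [localized'_torsionPart]
      have := injective_of_isLocalizedModule S (Localization S) (LocalizedModule.mkLinearMap S E)
      exact subsingleton_locCoh_quotient_torsionPart _
    let k := (IsLocalizedModule.map S f l g').extendScalarsOfIsLocalization S (Localization S)
    have hk : LinearMap.ker k ≤ torsionPart (a.map (algebraMap R (Localization S))) M' := by
      rw [← LinearMap.localized'_ker_eq_ker_localizedMap (Localization S) S f l g',
        ← localized'_torsionPart S (Localization S) f a]
      exact (Submodule.localized'gi (Localization S) S f).gc.monotone_l hg'
    obtain ⟨e'⟩ := nonempty_locCoh_succ_equiv _ i k hk hl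
    have hr := LinearMap.localized'_range_eq_range_localizedMap (Localization S) S f l g'
    obtain ⟨e₂⟩ := ih ((LinearMap.range g').toLocalizedQuotient' (Localization S) S l)
    rw [hr] at e₂
    exact ⟨((IsLocalizedModule.mapEquiv S (LocalizedModule.mkLinearMap S _)
      (LocalizedModule.mkLinearMap S _) (Localization S) e).trans e₂).trans e'.symm⟩

end Localization

section AlmostFG

variable {R : Type} [CommRing R]

lemma exists_fg_map_eq {M N : Type*} [AddCommGroup M] [Module R M] [AddCommGroup N] [Module R N]
    (g : M →ₗ[R] N) {P : Submodule R N} (hP : P.FG) (h : P ≤ LinearMap.range g) :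
    ∃ Q : Submodule R M, Q.FG ∧ Q.map g = P := by
  induction P, hP using Submodule.fg_induction with
  | singleton x =>
    obtain ⟨y, rfl⟩ := h (Submodule.mem_span_singleton_self x)
    exact ⟨R ∙ y, Submodule.fg_span_singleton y, by simp [Submodule.map_span]⟩
  | sup P₁ P₂ _ _ ih₁ ih₂ =>
    obtain ⟨Q₁, h₁, rfl⟩ := ih₁ (le_sup_left.trans h)
    obtain ⟨Q₂, h₂, rfl⟩ := ih₂ (le_sup_right.trans h)
    exact ⟨Q₁ ⊔ Q₂, h₁.sup h₂, Submodule.map_sup _ _ _⟩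

variable (W : Set (PrimeSpectrum R))

/-- A module is almost finitely generated with respect to a set `W` of primes if some quotient by a
finitely generated submodule has support disjoint from `W`. -/
def AlmostFG (M : Type*) [AddCommGroup M] [Module R M] : Prop :=
  ∃ N : Submodule R M, N.FG ∧ ∀ p ∈ W, ∀ x : M, ∃ c ∉ p.asIdeal, c • x ∈ N

variable {W}
variable {M N P : Type*} [AddCommGroup M] [Module R M] [AddCommGroup N] [Module R N]
  [AddCommGroup P] [Module R P]

lemma AlmostFG.of_finite [Module.Finite R M] : AlmostFG W M :=
  ⟨⊤, Module.Finite.fg_top, fun p _ _ => ⟨1, p.asIdeal.one_notMem, Submodule.mem_top⟩⟩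

lemma AlmostFG.of_disjoint_support (h : Disjoint (Module.support R M) W) : AlmostFG W M := by
  refine ⟨⊥, Submodule.fg_bot, fun p hp x => ?_⟩
  obtain ⟨c, hc, hx⟩ := Module.notMem_support_iff'.1 (h.notMem_of_mem_right hp) x
  exact ⟨c, hc, hx⟩

lemma AlmostFG.of_surjective (h : AlmostFG W M) {f : M →ₗ[R] N} (hf : Function.Surjective f) :
    AlmostFG W N := by
  obtain ⟨Q, hQ, h⟩ := h
  refine ⟨Q.map f, hQ.map f, fun p hp y => ?_⟩
  obtain ⟨x, rfl⟩ := hf y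
  obtain ⟨c, hc, hx⟩ := h p hp x
  exact ⟨c, hc, c • x, hx, map_smul _ _ _⟩

lemma AlmostFG.pi {ι : Type*} [Finite ι] (h : AlmostFG W M) : AlmostFG W (ι → M) := by
  have := Fintype.ofFinite ι
  obtain ⟨Q, hQ, h⟩ := h
  refine ⟨Submodule.pi Set.univ fun _ => Q, Submodule.fg_pi fun _ => hQ, fun p hp x => ?_⟩
  choose c hc hx using fun i => h p hp (x i)
  refine ⟨∏ i, c i, fun h' => ?_, fun i _ => ?_⟩
  · obtain ⟨i, -, hi⟩ := (p.2.prod_mem_iff).1 h'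
    exact hc i hi
  · obtain ⟨d, hd⟩ := Finset.dvd_prod_of_mem c (Finset.mem_univ i)
    rw [Pi.smul_apply, hd, mul_comm, mul_smul]
    exact Q.smul_mem d (hx i)

lemma AlmostFG.exists_finite_localized (h : AlmostFG W M) {p : PrimeSpectrum R} (hp : p ∈ W) :
    Module.Finite (Localization.AtPrime p.asIdeal) (LocalizedModule p.asIdeal.primeCompl M) := by
  classical
  obtain ⟨Q, ⟨s, rfl⟩, h⟩ := h
  let f := LocalizedModule.mkLinearMap p.asIdeal.primeCompl M
  refine ⟨⟨s.image f, ?_⟩⟩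
  rw [Finset.coe_image, ← Submodule.localized'_span (Localization.AtPrime p.asIdeal)
    p.asIdeal.primeCompl f, eq_top_iff]
  rintro x -
  obtain ⟨⟨x, t⟩, rfl⟩ := IsLocalizedModule.mk'_surjective p.asIdeal.primeCompl f x
  obtain ⟨c, hc, hx⟩ := h p hp x
  exact ⟨c • x, hx, ⟨c, hc⟩ * t, IsLocalizedModule.mk'_cancel_left f x ⟨c, hc⟩ t⟩

variable (R) in
/-- The primes of coheight at least `n`. -/
def primesOfLE (n : ℕ) : Set (PrimeSpectrum R) :=
  {p | (n : WithBot ℕ∞) ≤ ringKrullDim (R ⧸ p.asIdeal)}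

lemma mem_primesOfLE_of_le {n : ℕ} {p q : PrimeSpectrum R} (hpq : q ≤ p)
    (hp : p ∈ primesOfLE R n) : q ∈ primesOfLE R n :=
  hp.trans (ringKrullDim_le_of_surjective (Ideal.Quotient.factor hpq)
    (Ideal.Quotient.factor_surjective hpq))

lemma inDimLT_iff {M : Type} [AddCommGroup M] [Module R M] {n : ℕ} :
    InDimLT R M n ↔ AlmostFG (primesOfLE R n) M := by
  refine exists_congr fun N => and_congr_right fun _ => ?_
  have h : (∀ p ∈ primesOfLE R n, ∀ x : M, ∃ c ∉ p.asIdeal, c • x ∈ N) ↔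
      ∀ p ∈ primesOfLE R n, p ∉ Module.support R (M ⧸ N) := by
    refine forall₂_congr fun p _ => ?_
    rw [Module.notMem_support_iff', N.mkQ_surjective.forall]
    simp only [Submodule.mkQ_apply, ← Submodule.Quotient.mk_smul, Submodule.Quotient.mk_eq_zero]
  rw [h, ← not_le, Order.le_krullDim_iff]
  constructor
  · intro H p hp hps
    refine H (Order.le_krullDim_iff.1 (hp.trans ?_))
    rw [ringKrullDim_quotient]
    refine Order.krullDim_le_of_strictMono
      (fun q => ⟨q.1, Module.mem_support_mono (show p ≤ q.1 from q.2) hps⟩) fun _ _ h => h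
  · rintro H ⟨l, hl⟩
    refine H (l.head).1 ?_ l.head.2
    change (n : WithBot ℕ∞) ≤ _
    rw [ringKrullDim_quotient, Order.le_krullDim_iff]
    exact ⟨{ length := l.length
             toFun := fun i => ⟨(l i).1, l.head_le i⟩
             step := fun i => l.step i }, hl⟩

variable [IsNoetherianRing R]

lemma AlmostFG.of_injective (h : AlmostFG W N) {f : M →ₗ[R] N} (hf : Function.Injective f) :
    AlmostFG W M := by
  obtain ⟨Q, hQ, h⟩ := h
  refine ⟨Q.comap f, ?_, fun p hp x => h p hp (f x) |>.imp fun c hc => ⟨hc.1, ?_⟩⟩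
  · have : Module.Finite R Q := Module.Finite.iff_fg.2 hQ
    refine Submodule.fg_of_fg_map_injective f hf ?_
    exact Submodule.FG.of_le hQ (Submodule.map_comap_le f Q)
  · simpa using hc.2

lemma AlmostFG.of_exact (hM : AlmostFG W M) (hP : AlmostFG W P) {f : M →ₗ[R] N} {g : N →ₗ[R] P}
    (h : Function.Exact f g) : AlmostFG W N := by
  obtain ⟨Q₁, hQ₁, h₁⟩ := hM
  obtain ⟨Q₂, hQ₂, h₂⟩ := hP.of_injective (LinearMap.range g).subtype_injective
  obtain ⟨Q, hQ, rfl⟩ := exists_fg_map_eq g.rangeRestrict hQ₂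
    (by rw [LinearMap.range_rangeRestrict]; exact le_top)
  refine ⟨Q₁.map f ⊔ Q, (hQ₁.map f).sup hQ, fun p hp x => ?_⟩
  obtain ⟨c, hc, y, hy, hxy⟩ := h₂ p hp (g.rangeRestrict x)
  have hxy' : g (c • x - y) = 0 := by
    rw [map_sub, map_smul, sub_eq_zero]
    exact (congrArg Subtype.val hxy).symm
  obtain ⟨z, hz⟩ := (h _).1 hxy'
  obtain ⟨d, hd, hz'⟩ := h₁ p hp z
  refine ⟨d * c, fun h' => (p.2.mem_or_mem h').elim hd hc, ?_⟩
  have : (d * c) • x = f (d • z) + d • y := by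
    rw [map_smul, hz, smul_sub, mul_smul, sub_add_cancel]
  rw [this]
  exact add_mem (Submodule.mem_sup_left ⟨_, hz', rfl⟩) (Submodule.mem_sup_right (Q.smul_mem d hy))

end AlmostFG

section ExtAlmostFG

variable (R : Type) [CommRing R]

/-- The module `Ext^i(X, Y)`. -/
abbrev ExtModule (X Y : Type) [AddCommGroup X] [Module R X] [AddCommGroup Y] [Module R Y]
    (i : ℕ) : Type :=
  Abelian.Ext (ModuleCat.of R X) (ModuleCat.of R Y) i

variable {R}
variable (X : Type) [AddCommGroup X] [Module R X]
variable {Y M N P : Type} [AddCommGroup Y] [Module R Y] [AddCommGroup M] [Module R M]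
  [AddCommGroup N] [Module R N] [AddCommGroup P] [Module R P]

/-- The linear map `Ext^i(X, M) → Ext^i(X, N)` induced by a linear map `M → N`. -/
def extMap (i : ℕ) (f : M →ₗ[R] N) : ExtModule R X M i →ₗ[R] ExtModule R X N i :=
  (Abelian.Ext.mk₀ (ModuleCat.ofHom f)).postcompOfLinear R _ (add_zero i)

lemma exists_ext_connecting (i : ℕ) {f : M →ₗ[R] N} {g : N →ₗ[R] P} (hf : Function.Injective f)
    (hfg : Function.Exact f g) (hg : Function.Surjective g) :
    ∃ δ : ExtModule R X P i →ₗ[R] ExtModule R X M (i + 1),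
      Function.Exact (extMap X i g) δ ∧ Function.Exact δ (extMap X (i + 1) f) := by
  obtain ⟨w, h⟩ := shortExact_ofHom hf hfg hg
  refine ⟨h.extClass.postcompOfLinear R _ rfl, fun x => ⟨fun hx =>
    Abelian.Ext.covariant_sequence_exact₃ _ h x rfl hx, ?_⟩,
    fun x => ⟨fun hx => Abelian.Ext.covariant_sequence_exact₁ _ h x hx rfl, ?_⟩⟩
  · rintro ⟨y, rfl⟩
    simpa [extMap, Abelian.Ext.comp_assoc_of_second_deg_zero] using
      congrArg (fun z => Abelian.Ext.comp y z rfl) h.comp_extClass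
  · rintro ⟨y, rfl⟩
    simpa [extMap, Abelian.Ext.comp_assoc_of_third_deg_zero] using
      congrArg (fun z => Abelian.Ext.comp y z rfl) h.extClass_comp

lemma subsingleton_ext_of_torsion (a : Ideal R) (h : torsionPart a Y = ⊥) :
    Subsingleton (ExtModule R (R ⧸ a) Y 0) := by
  let e := (Abelian.Ext.linearEquiv₀ (R := R) (X := ModuleCat.of R (R ⧸ a))
    (Y := ModuleCat.of R Y)).trans ModuleCat.homLinearEquiv
  refine e.toEquiv.subsingleton_congr.2 ?_
  refine subsingleton_of_forall_eq 0 fun f => LinearMap.ext fun x => ?_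
  have : f x ∈ torsionPart a Y := ⟨1, fun r hr => by
    obtain ⟨x, rfl⟩ := Ideal.Quotient.mk_surjective x
    have : r • (Ideal.Quotient.mk a x) = 0 := by
      rw [← Ideal.Quotient.mk_eq_mk, ← Submodule.Quotient.mk_smul, Submodule.Quotient.mk_eq_zero]
      exact Ideal.mul_mem_right _ _ (by simpa using hr)
    rw [← map_smul]
    exact (congrArg f this).trans (map_zero f)⟩
  rw [h] at this
  exact this

lemma subsingleton_ext_succ_of_injective [Module.Injective R Y] (i : ℕ) :
    Subsingleton (ExtModule R X Y (i + 1)) :=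
  have : Injective (ModuleCat.of R Y) := Module.injective_object_of_injective_module R Y
  Abelian.Ext.subsingleton_of_injective _ _ i

variable [IsNoetherianRing R]

lemma subsingleton_ext_quotient_torsionPart (a : Ideal R) [Module.Injective R Y] (i : ℕ) :
    Subsingleton (ExtModule R (R ⧸ a) (Y ⧸ torsionPart a Y) i) := by
  cases i with
  | zero => exact subsingleton_ext_of_torsion a (torsionPart_quotient_torsionPart a Y)
  | succ i =>
    obtain ⟨δ, h₁, h₂⟩ := exists_ext_connecting (R ⧸ a) (i + 1) (torsionPart a Y).subtype_injective
      (LinearMap.exact_subtype_mkQ (torsionPart a Y)) (torsionPart a Y).mkQ_surjective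
    have := injective_torsionPart a (E := Y)
    have := subsingleton_ext_succ_of_injective (R := R) (R ⧸ a) (Y := Y) i
    have := subsingleton_ext_succ_of_injective (R := R) (R ⧸ a) (Y := torsionPart a Y) (i + 1)
    exact subsingleton_of_exact h₁

variable {W : Set (PrimeSpectrum R)}

lemma AlmostFG.ext (h : AlmostFG W Y) (i : ℕ) [Module.Finite R X] :
    AlmostFG W (ExtModule R X Y i) := by
  induction i generalizing X with
  | zero =>
    obtain ⟨m, f, hf⟩ := Module.Finite.exists_fin' R X
    let φ : (X →ₗ[R] Y) →ₗ[R] (Fin m → Y) :=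
      LinearMap.pi fun j => LinearMap.applyₗ (f (Pi.single j 1))
    have hφ : Function.Injective φ := fun u v huv => by
      refine (LinearMap.cancel_right hf).1 ?_
      ext j
      simpa [φ] using congrFun huv j
    exact (h.pi (ι := Fin m)).of_injective (f := φ ∘ₗ
      ((Abelian.Ext.linearEquiv₀ (R := R)).trans ModuleCat.homLinearEquiv).toLinearMap)
      (hφ.comp (LinearEquiv.injective _))
  | succ i ih =>
    obtain ⟨m, f, hf⟩ := Module.Finite.exists_fin' R X
    obtain ⟨w, hS⟩ := shortExact_ofHom (LinearMap.ker f).subtype_injective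
      (LinearMap.exact_subtype_ker_map f) hf
    have : Projective (ModuleCat.of R (Fin m → R)) :=
      (IsProjective.iff_projective _).1 inferInstance
    exact (ih (LinearMap.ker f)).of_surjective
      (f := hS.extClass.precompOfLinear R (ModuleCat.of R Y) (add_comm 1 i))
      fun x => Abelian.Ext.contravariant_sequence_exact₃ hS _ x
        (Abelian.Ext.eq_zero_of_projective (P := ModuleCat.of R (Fin m → R)) _) (add_comm 1 i)

end ExtAlmostFG

section TorsionBySet

variable {R : Type} [CommRing R] [IsNoetherianRing R] (a : Ideal R) {W : Set (PrimeSpectrum R)}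

open Submodule in
variable {a} in
lemma AlmostFG.torsionBySet_of_injective {M N : Type*} [AddCommGroup M] [Module R M]
    [AddCommGroup N] [Module R N] (h : AlmostFG W (torsionBySet R N (a : Set R))) {f : M →ₗ[R] N}
    (hf : Function.Injective f) : AlmostFG W (torsionBySet R M (a : Set R)) := by
  have hfa (x) (hx : x ∈ torsionBySet R M (a : Set R)) : f x ∈ torsionBySet R N (a : Set R) := by
    rw [mem_torsionBySet_iff] at hx ⊢
    exact fun r => by rw [← map_smul, hx r, map_zero]
  refine h.of_injective (f := f.restrict hfa) fun x y hxy => ?_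
  exact Subtype.ext (hf (congrArg Subtype.val hxy))

open Submodule in
/-- If `Ext^j(R/a, Y)` is in the class for `j ≤ t` and `H^j_a(Y)` is in the class for `j < t`, then
so is the part of `H^t_a(Y)` killed by `a`. -/
lemma AlmostFG.torsionBySet_locCoh (t : ℕ) (Y : Type) [AddCommGroup Y] [Module R Y]
    (hExt : ∀ j ≤ t, AlmostFG W (ExtModule R (R ⧸ a) Y j))
    (hY : ∀ j < t, AlmostFG W (locCoh R a j Y)) :
    AlmostFG W (torsionBySet R (locCoh R a t Y) (a : Set R)) := by
  induction t generalizing Y with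
  | zero =>
    have h : AlmostFG W ((R ⧸ a) →ₗ[R] Y) := (hExt 0 le_rfl).of_surjective
      (f := ((Abelian.Ext.linearEquiv₀ (R := R)).trans ModuleCat.homLinearEquiv).toLinearMap)
      (LinearEquiv.surjective _)
    let φ : ((R ⧸ a) →ₗ[R] Y) →ₗ[R] Y := LinearMap.applyₗ (Ideal.Quotient.mk a 1)
    have hφ (x) (hx : x ∈ torsionBySet R Y (a : Set R)) : x ∈ LinearMap.range φ := by
      rw [mem_torsionBySet_iff] at hx
      refine ⟨a.liftQ (LinearMap.toSpanSingleton R Y x) fun r hr => hx ⟨r, hr⟩, ?_⟩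
      exact one_smul R x
    have h' : AlmostFG W (torsionBySet R Y (a : Set R)) :=
      (h.of_surjective φ.surjective_rangeRestrict).of_injective
        (f := Submodule.inclusion hφ) (Submodule.inclusion_injective _)
    exact (h'.torsionBySet_of_injective
      (torsionPart a Y).subtype_injective).torsionBySet_of_injective (locCohZeroEquiv a Y).injective
  | succ t ih =>
    obtain ⟨E, _, _, f, hE, hf⟩ := exists_injective_embedding R Y
    let g := (torsionPart a E).mkQ ∘ₗ f
    have hg : LinearMap.ker g ≤ torsionPart a Y := ker_mkQ_comp_le a hf
    have e (j) : locCoh R a (j + 1) Y ≃ₗ[R]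
        locCoh R a j ((E ⧸ torsionPart a E) ⧸ LinearMap.range g) :=
      (nonempty_locCoh_succ_equiv a j g hg (subsingleton_locCoh_quotient_torsionPart a)).some
    have hK : AlmostFG W (LinearMap.ker g) :=
      ((hY 0 t.succ_pos).of_surjective (locCohZeroEquiv a Y).surjective).of_injective
        (Submodule.inclusion_injective hg)
    have hrange (j) (hj : j ≤ t + 1) : AlmostFG W (ExtModule R (R ⧸ a) (LinearMap.range g) j) := by
      obtain ⟨δ, h, -⟩ := exists_ext_connecting (R ⧸ a) j (LinearMap.ker g).subtype_injective
        (f := (LinearMap.ker g).subtype) (g := g.rangeRestrict)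
        (by rw [LinearMap.exact_iff]; simp) g.surjective_rangeRestrict
      exact (hExt j hj).of_exact (hK.ext (R ⧸ a) (j + 1)) h
    refine (ih _ (fun j hj => ?_) fun j hj => ?_).torsionBySet_of_injective (e t).injective
    · obtain ⟨δ, h, -⟩ := exists_ext_connecting (R ⧸ a) j (LinearMap.range g).subtype_injective
        (LinearMap.exact_subtype_mkQ (LinearMap.range g)) (LinearMap.range g).mkQ_surjective
      have := subsingleton_ext_quotient_torsionPart (R := R) (Y := E) a j
      exact AlmostFG.of_exact .of_finite (hrange (j + 1) (by lia)) h
    · exact (hY (j + 1) (by lia)).of_surjective (e j).surjective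

end TorsionBySet

section AssociatedPrimes

variable {R : Type} [CommRing R] [IsNoetherianRing R] {a : Ideal R} {W : Set (PrimeSpectrum R)}
variable {H : Type} [AddCommGroup H] [Module R H]

lemma mem_associatedPrimes_iff_exists_forall {p : PrimeSpectrum R} :
    p.asIdeal ∈ associatedPrimes R H ↔ ∃ x : H, ∀ r, r • x = 0 ↔ r ∈ p.asIdeal := by
  rw [AssociatedPrimes.mem_iff, isAssociatedPrime_iff, and_iff_right p.isPrime]
  refine exists_congr fun x => ?_
  rw [SetLike.ext_iff]
  simp_rw [Submodule.mem_colon_singleton, Submodule.mem_bot, iff_comm]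

lemma le_of_mem_associatedPrimes (ha : torsionPart a H = ⊤) {p : PrimeSpectrum R}
    (hp : p.asIdeal ∈ associatedPrimes R H) : a ≤ p.asIdeal := by
  obtain ⟨x, hx⟩ := mem_associatedPrimes_iff_exists_forall.1 hp
  obtain ⟨k, hk⟩ : x ∈ torsionPart a H := ha ▸ Submodule.mem_top
  exact p.isPrime.le_of_pow_le fun r hr => (hx r).1 (hk r hr)

lemma finite_associatedPrimes_inter (ha : torsionPart a H = ⊤)
    (hQ : AlmostFG W (Submodule.torsionBySet R H (a : Set R))) :
    {p ∈ W | p.asIdeal ∈ associatedPrimes R H}.Finite := by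
  obtain ⟨N, hN, h⟩ := hQ
  have := Module.Finite.iff_fg.2 hN
  refine Set.Finite.preimage (f := PrimeSpectrum.asIdeal) (fun p _ q _ => PrimeSpectrum.ext)
    (associatedPrimes.finite R N) |>.subset ?_
  rintro p ⟨hpW, hp⟩
  have hap := le_of_mem_associatedPrimes ha hp
  obtain ⟨x, hx⟩ := mem_associatedPrimes_iff_exists_forall.1 hp
  have hxa : x ∈ Submodule.torsionBySet R H (a : Set R) := by
    rw [Submodule.mem_torsionBySet_iff]
    exact fun r => (hx r).2 (hap r.2)
  obtain ⟨c, hc, hcN⟩ := h p hpW ⟨x, hxa⟩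
  refine mem_associatedPrimes_iff_exists_forall.2 ⟨⟨_, hcN⟩, fun r => ?_⟩
  rw [← Subtype.coe_inj, ← Subtype.coe_inj]
  change r • c • x = 0 ↔ _
  rw [← mul_smul, hx]
  exact ⟨fun h => (p.isPrime.mem_or_mem h).resolve_right hc, fun h => Ideal.mul_mem_right _ _ h⟩

lemma exists_pow_smul_eq_zero_of_finite_localized (ha : torsionPart a H = ⊤) (p : PrimeSpectrum R)
    (hp : Module.Finite (Localization.AtPrime p.asIdeal)
      (LocalizedModule p.asIdeal.primeCompl H)) :
    ∃ k : ℕ, ∀ r ∈ a ^ k, ∀ x : H, ∃ c ∉ p.asIdeal, c • r • x = 0 := by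
  let A := Localization.AtPrime p.asIdeal
  let f := LocalizedModule.mkLinearMap p.asIdeal.primeCompl H
  have h := localized'_torsionPart p.asIdeal.primeCompl A f a
  rw [ha, Submodule.localized'_top] at h
  obtain ⟨k, hk⟩ := exists_pow_smul_eq_zero (a.map (algebraMap R A)) hp.fg_top h.le
  refine ⟨k, fun r hr x => ?_⟩
  have := hk (algebraMap R A r) (by rw [← Ideal.map_pow]; exact Ideal.mem_map_of_mem _ hr) (f x)
    Submodule.mem_top
  rw [algebraMap_smul, ← map_smul, IsLocalizedModule.eq_zero_iff p.asIdeal.primeCompl] at this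
  obtain ⟨c, hc⟩ := this
  exact ⟨c, c.2, hc⟩

lemma exists_smul_eq_zero_of_associatedPrimes
    (hW : ∀ p ∈ W, ∀ q ≤ p, q ∈ W) {s : R}
    (h : ∀ p ∈ W, p.asIdeal ∈ associatedPrimes R H → ∀ x : H, ∃ c ∉ p.asIdeal, c • s • x = 0)
    {p : PrimeSpectrum R} (hp : p ∈ W) (x : H) : ∃ c ∉ p.asIdeal, c • s • x = 0 := by
  by_contra! hx
  let L := Submodule.span R {s • x}
  have hL : Module.annihilator R L ≤ p.asIdeal := fun r hr => by
    by_contra hr'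
    exact hx r hr' (congrArg Subtype.val
      (Module.mem_annihilator.1 hr ⟨_, Submodule.mem_span_singleton_self _⟩))
  obtain ⟨q, hq, hqp⟩ := Ideal.exists_minimalPrimes_le hL
  let q' : PrimeSpectrum R := ⟨q, hq.1.1⟩
  have hqL : q'.asIdeal ∈ associatedPrimes R L :=
    Module.associatedPrimes.minimalPrimes_annihilator_subset_associatedPrimes R L hq
  obtain ⟨⟨y, hy⟩, hyq⟩ := mem_associatedPrimes_iff_exists_forall.1 hqL
  obtain ⟨t, rfl⟩ := Submodule.mem_span_singleton.1 hy
  obtain ⟨c, hc, hcx⟩ := h q' (hW p hp q' hqp)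
    (associatedPrimes.subset_of_injective (Submodule.subtype_injective L) hqL) (t • x)
  refine hc ((hyq c).1 (Subtype.ext ?_))
  rw [smul_comm s t x] at hcx
  exact hcx

lemma AlmostFG.of_smul_top (h₁ : AlmostFG W (Submodule.torsionBySet R H (a : Set R)))
    (h₂ : AlmostFG W (a • ⊤ : Submodule R H)) : AlmostFG W H := by
  obtain ⟨m, s, hs⟩ := Submodule.fg_iff_exists_fin_generating_family.1 (IsNoetherian.noetherian a)
  have hsa (i) : s i ∈ a := hs ▸ Submodule.subset_span ⟨i, rfl⟩
  let φ : H →ₗ[R] (Fin m → (a • ⊤ : Submodule R H)) := LinearMap.pi fun i =>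
    (LinearMap.lsmul R H (s i)).codRestrict _ fun x =>
      Submodule.smul_mem_smul (hsa i) Submodule.mem_top
  have hφ (x) (hx : x ∈ LinearMap.ker φ) : x ∈ Submodule.torsionBySet R H (a : Set R) := by
    rw [← hs, ← Submodule.torsionBySet_eq_torsionBySet_span, Submodule.mem_torsionBySet_iff]
    rintro ⟨_, i, rfl⟩
    exact congrArg Subtype.val (congrFun hx i)
  exact (h₁.of_injective (Submodule.inclusion_injective hφ)).of_exact h₂.pi
    (LinearMap.exact_subtype_ker_map φ)

lemma AlmostFG.torsionBySet_pow (h : AlmostFG W (Submodule.torsionBySet R H (a : Set R))) (k : ℕ) :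
    AlmostFG W (Submodule.torsionBySet R H ((a ^ k : Ideal R) : Set R)) := by
  induction k with
  | zero =>
    have : Subsingleton (Submodule.torsionBySet R H ((a ^ 0 : Ideal R) : Set R)) := by
      refine subsingleton_of_forall_eq 0 fun x => Subtype.ext ?_
      simpa using (Submodule.mem_torsionBySet_iff _ _).1 x.2 ⟨1, by simp⟩
    exact .of_finite
  | succ k ih =>
    refine .of_smul_top (a := a) (h.torsionBySet_of_injective (Submodule.subtype_injective _)) ?_
    have hle : ∀ x ∈ (a • ⊤ : Submodule R
        (Submodule.torsionBySet R H ((a ^ (k + 1) : Ideal R) : Set R))),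
        (Submodule.subtype _) x ∈ Submodule.torsionBySet R H ((a ^ k : Ideal R) : Set R) := by
      refine fun x hx => Submodule.smul_induction_on hx (fun r hr y _ => ?_)
        fun x y hx hy => by simpa using add_mem hx hy
      rw [Submodule.mem_torsionBySet_iff]
      intro t
      have := (Submodule.mem_torsionBySet_iff _ _).1 y.2
        ⟨t * r, by rw [pow_succ]; exact Ideal.mul_mem_mul t.2 hr⟩
      simpa [mul_smul] using this
    exact ih.of_injective (f := (Submodule.subtype _).restrict hle) fun x y hxy =>
      by
      have := congrArg Subtype.val hxy
      exact Subtype.ext (Subtype.ext this)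

/-- An `a`-torsion module is in the class of almost finitely generated modules if the part killed by
`a` is and if it is finitely generated at its associated primes in `W`. -/
lemma AlmostFG.of_torsionBySet (hW : ∀ p ∈ W, ∀ q ≤ p, q ∈ W) (ha : torsionPart a H = ⊤)
    (hQ : AlmostFG W (Submodule.torsionBySet R H (a : Set R)))
    (h : ∀ p ∈ W, p.asIdeal ∈ associatedPrimes R H →
      Module.Finite (Localization.AtPrime p.asIdeal) (LocalizedModule p.asIdeal.primeCompl H)) :
    AlmostFG W H := by
  have hfin := finite_associatedPrimes_inter ha hQ
  have h' (p : PrimeSpectrum R) (hp : p ∈ W ∧ p.asIdeal ∈ associatedPrimes R H) :=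
    exists_pow_smul_eq_zero_of_finite_localized ha p (h p hp.1 hp.2)
  choose! k hk using h'
  obtain ⟨K, hK⟩ := (hfin.image k).bddAbove
  refine .of_smul_top (a := a ^ K) (hQ.torsionBySet_pow K) (.of_disjoint_support ?_)
  refine Set.disjoint_right.2 fun p hp => Module.notMem_support_iff'.2 fun x => ?_
  have hx : ∃ c ∉ p.asIdeal, c • (x : H) = 0 := by
    refine Submodule.smul_induction_on x.2 (fun r hr y _ => ?_) ?_
    · refine exists_smul_eq_zero_of_associatedPrimes hW (fun q hq hqH => ?_) hp y
      exact hk q ⟨hq, hqH⟩ r (Ideal.pow_le_pow_right (hK ⟨q, ⟨hq, hqH⟩, rfl⟩) hr)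
    · rintro y z ⟨c, hc, hy⟩ ⟨d, hd, hz⟩
      refine ⟨c * d, fun h => (p.isPrime.mem_or_mem h).elim hc hd, ?_⟩
      rw [smul_add, mul_smul c d z, hz, mul_comm, mul_smul, hy, smul_zero, smul_zero, add_zero]
  obtain ⟨c, hc, hx⟩ := hx
  exact ⟨c, hc, Subtype.ext hx⟩

end AssociatedPrimes

section LocalGlobal

variable {R : Type} [CommRing R] [IsNoetherianRing R] (a : Ideal R)
variable (M : Type) [AddCommGroup M] [Module R M]

lemma subsingleton_locCoh [Subsingleton M] (i : ℕ) : Subsingleton (locCoh R a i M) := by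
  cases i with
  | zero => exact subsingleton_locCoh_zero a (Subsingleton.elim _ _)
  | succ i => exact subsingleton_locCoh_succ_of_torsion a i (Subsingleton.elim _ _)

/-- Local cohomology commutes with localization at a prime. -/
lemma nonempty_localizedModule_locCoh_equiv_atPrime (i : ℕ) (p : PrimeSpectrum R) :
    Nonempty (LocalizedModule p.asIdeal.primeCompl (locCoh R a i M)
      ≃ₗ[Localization.AtPrime p.asIdeal]
      locCoh (Localization.AtPrime p.asIdeal)
        (a.map (algebraMap R (Localization.AtPrime p.asIdeal))) i
        (LocalizedModule p.asIdeal.primeCompl M)) :=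
  nonempty_localizedModule_locCoh_equiv p.asIdeal.primeCompl a i
    (LocalizedModule.mkLinearMap p.asIdeal.primeCompl M)

lemma support_locCoh_subset (i : ℕ) : Module.support R (locCoh R a i M) ⊆ Module.support R M := by
  intro p hp
  contrapose! hp
  rw [Module.notMem_support_iff] at hp ⊢
  have : IsNoetherianRing (Localization.AtPrime p.asIdeal) :=
    IsLocalization.isNoetherianRing p.asIdeal.primeCompl _ inferInstance
  obtain ⟨e⟩ := nonempty_localizedModule_locCoh_equiv_atPrime a M i p
  have := subsingleton_locCoh (a.map (algebraMap R (Localization.AtPrime p.asIdeal)))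
    (LocalizedModule p.asIdeal.primeCompl M) i
  exact e.toEquiv.subsingleton

lemma inDimLT_locCoh [Module.Finite R M] (n i : ℕ)
    (h : ∀ p : PrimeSpectrum R, p ∈ Module.support R (M ⧸ (a • ⊤ : Submodule R M)) →
      (n : WithBot ℕ∞) ≤ ringKrullDim (R ⧸ p.asIdeal) → ∀ j ≤ i,
      Module.Finite (Localization.AtPrime p.asIdeal) (locCoh (Localization.AtPrime p.asIdeal)
        (a.map (algebraMap R (Localization.AtPrime p.asIdeal))) j
        (LocalizedModule p.asIdeal.primeCompl M))) :
    InDimLT R (locCoh R a i M) n := by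
  rw [inDimLT_iff]
  induction i using Nat.strong_induction_on with
  | h i ih =>
    have ha := torsionPart_locCoh a i M
    refine .of_torsionBySet (fun p hp q hqp => mem_primesOfLE_of_le hqp hp) ha
      (.torsionBySet_locCoh a i M (fun j _ => .of_finite) fun j hj =>
        ih j hj fun p hp hpn k hk => h p hp hpn k (hk.trans hj.le)) fun p hp hpH => ?_
    have hpM : p ∈ Module.support R (M ⧸ (a • ⊤ : Submodule R M)) := by
      rw [Module.support_quotient]
      refine ⟨support_locCoh_subset a M i ?_, le_of_mem_associatedPrimes ha hpH⟩
      obtain ⟨x, hx⟩ := mem_associatedPrimes_iff_exists_forall.1 hpH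
      exact Module.mem_support_iff'.2 ⟨x, fun r hr h => hr ((hx r).1 h)⟩
    obtain ⟨e⟩ := nonempty_localizedModule_locCoh_equiv_atPrime a M i p
    have := h p hpM hp i le_rfl
    exact .equiv e.symm

end LocalGlobal

/-- Faltings' local-global principle: for a Noetherian ring `R`, an ideal `a` and a finitely
generated `R`-module `M`, the `n`-th finiteness dimension `f_a^n(M)` equals `h_a^n(M)`, the
least `i` such that `H^i_a(M)` is not in dimension `< n`. -/
theorem finDimN_eq_hDimN (R : Type) [CommRing R] [IsNoetherianRing R] (a : Ideal R)
    (M : Type) [AddCommGroup M] [Module R M] [Module.Finite R M] (n : ℕ) :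
    finDimN R a n M = hDimN R a n M := by
  refine le_antisymm (le_sInf ?_) (le_sInf ?_)
  · rintro _ ⟨i, hi, rfl⟩
    by_contra! hlt
    refine hi (inDimLT_locCoh a M n i fun p hp hpn j hj => ?_)
    by_contra hfin
    have h₁ : finDimN R a n M ≤ j :=
      le_trans (b := finDim _ _ _) (sInf_le ⟨p, hp, hpn, rfl⟩) (sInf_le ⟨j, hfin, rfl⟩)
    exact hlt.not_ge (h₁.trans (by exact_mod_cast hj))
  · rintro _ ⟨p, hp, hpn, rfl⟩
    refine le_sInf ?_
    rintro _ ⟨i, hi, rfl⟩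
    refine sInf_le ⟨i, fun h => hi ?_, rfl⟩
    obtain ⟨e⟩ := nonempty_localizedModule_locCoh_equiv_atPrime a M i p
    have := (inDimLT_iff.1 h).exists_finite_localized (p := p) hpn
    exact .equiv e
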